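/- arXiv:1502.02413 — 3 statements merged into one kernel-verified Lean document; each statement's English description precedes it below -/
import Mathlib

section
/- Let G be a countable amenable group, Λ a finite alphabet, x ∈ Λ^G, F ⊆ G a finite nonempty set, and B ∈ Λ^F a block. Then for every G-invariant Borel probability measure μ on Λ^G whose support is contained in the shift-orbit closure of x, one has μ([B]) ≤ D̄({g ∈ G : (gx)|_F = B}), where D̄ denotes upper Banach density and [B] = {y ∈ Λ^G : y|_F = B}. -/
open scoped Pointwise symmDiff Classical
open Filter

namespace AmenableTilings

variable {G : Type*}

/-- The left translate `gF` of a finite set `F`. -/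
noncomputable def lMul [Group G] (g : G) (F : Finset G) : Finset G := F.image (fun h => g * h)

/-- The right translate `Fg` of a finite set `F`. -/
noncomputable def rMul [Group G] (F : Finset G) (g : G) : Finset G := F.image (fun h => h * g)

/-- A Følner sequence: a sequence of finite nonempty sets with `|gFₙ Δ Fₙ|/|Fₙ| → 0`
for every `g`. -/
def IsFolnerSeq [Group G] (F : ℕ → Finset G) : Prop :=
  (∀ n, (F n).Nonempty) ∧
  ∀ g : G, Tendsto (fun n => (((lMul g (F n)) ∆ (F n)).card : ℝ) / ((F n).card : ℝ))
    atTop (nhds 0)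

/-- A group is amenable if it admits a Følner sequence. -/
def IsAmenable (G : Type*) [Group G] : Prop := ∃ F : ℕ → Finset G, IsFolnerSeq F

/-- `(K,ε)`-invariance: `|KT Δ T| < ε|T|`, where `KT = {gh : g ∈ K, h ∈ T}`. -/
def KInvariant [Group G] (K T : Finset G) (ε : ℝ) : Prop :=
  (((K * T) ∆ T).card : ℝ) < ε * (T.card : ℝ)

/-- `|S ∩ Fg|`. -/
noncomputable def interCard [Group G] (S : Set G) (F : Finset G) (g : G) : ℕ :=
  ((rMul F g).filter (fun h => h ∈ S)).card

/-- `D̲_F(S) = inf_g |S ∩ Fg| / |F|`. -/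
noncomputable def lowerD [Group G] (S : Set G) (F : Finset G) : ℝ :=
  ⨅ g : G, (interCard S F g : ℝ) / (F.card : ℝ)

/-- `D̄_F(S) = sup_g |S ∩ Fg| / |F|`. -/
noncomputable def upperD [Group G] (S : Set G) (F : Finset G) : ℝ :=
  ⨆ g : G, (interCard S F g : ℝ) / (F.card : ℝ)

/-- Lower Banach density: `sup { D̲_F(S) : F finite nonempty }`. -/
noncomputable def lowerBD [Group G] (S : Set G) : ℝ :=
  sSup {r : ℝ | ∃ F : Finset G, F.Nonempty ∧ r = lowerD S F}

/-- Upper Banach density: `inf { D̄_F(S) : F finite nonempty }`. -/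
noncomputable def upperBD [Group G] (S : Set G) : ℝ :=
  sInf {r : ℝ | ∃ F : Finset G, F.Nonempty ∧ r = upperD S F}

/-- The shift action of `G` on `Λ^G`: `(gx)(h) = x(hg)`. -/
def shift [Group G] {Λ : Type*} (g : G) (x : G → Λ) : G → Λ := fun h => x (h * g)

/-- The orbit closure of `x ∈ Λ^G` under the shift action (with `Λ` discrete and
`Λ^G` carrying the product topology). -/
noncomputable def orbitClosure [Group G] {Λ : Type*} (x : G → Λ) : Set (G → Λ) :=
  @closure _ (@Pi.topologicalSpace G (fun _ => Λ) (fun _ => ⊥)) {y | ∃ g : G, y = shift g x}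

/-- `N_X(F)`: the number of blocks with domain `F` occurring in `X`. -/
noncomputable def complexity [Group G] {Λ : Type*} (X : Set (G → Λ)) (F : Finset G) : ℕ :=
  Set.ncard ((fun x (f : {a // a ∈ F}) => x f.1) '' X)

/-- Topological entropy of a symbolic system:
`inf { (1/|F|) log₂ N_X(F) : F finite nonempty }`. -/
noncomputable def entropyOf [Group G] {Λ : Type*} (X : Set (G → Λ)) : ℝ :=
  sInf {r : ℝ | ∃ F : Finset G, F.Nonempty ∧
    r = Real.logb 2 (complexity X F) / (F.card : ℝ)}

/-- The entropy of (the shift-orbit closure of) a symbolic element. -/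
noncomputable def pointEntropy [Group G] {Λ : Type*} (x : G → Λ) : ℝ :=
  entropyOf (orbitClosure x)

/-- A quasitiling of `G`: finitely many finite shapes containing the identity,
with pairwise disjoint center sets, such that the map `(S,c) ↦ Sc` is injective. -/
structure Quasitiling (G : Type*) [Group G] where
  shapes : Finset (Finset G)
  centers : Finset G → Set G
  one_mem : ∀ S ∈ shapes, (1 : G) ∈ S
  centers_empty : ∀ S, S ∉ shapes → centers S = ∅
  centers_disjoint : ∀ S ∈ shapes, ∀ S' ∈ shapes, S ≠ S' → Disjoint (centers S) (centers S')
  tiles_inj : ∀ S ∈ shapes, ∀ S' ∈ shapes, ∀ c ∈ centers S, ∀ c' ∈ centers S',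
    rMul S c = rMul S' c' → S = S' ∧ c = c'

namespace Quasitiling

variable [Group G]

/-- `(S,c)` is a tile of the quasitiling. -/
def IsTile (𝒯 : Quasitiling G) (S : Finset G) (c : G) : Prop :=
  S ∈ 𝒯.shapes ∧ c ∈ 𝒯.centers S

/-- The union of all tiles of the quasitiling. -/
def union (𝒯 : Quasitiling G) : Set G :=
  ⋃ S ∈ 𝒯.shapes, ⋃ c ∈ 𝒯.centers S, (↑(rMul S c) : Set G)

/-- `f` witnesses `ε`-disjointness: it assigns to each tile a `(1-ε)`-subset, and the
assigned subsets of distinct tiles are pairwise disjoint. -/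
def EpsDisjointWith (𝒯 : Quasitiling G) (ε : ℝ) (f : Finset G → G → Finset G) : Prop :=
  (∀ S c, 𝒯.IsTile S c →
    f S c ⊆ rMul S c ∧ (1 - ε) * (S.card : ℝ) ≤ ((f S c).card : ℝ)) ∧
  (∀ S c S' c', 𝒯.IsTile S c → 𝒯.IsTile S' c' → (S, c) ≠ (S', c') →
    Disjoint (f S c) (f S' c'))

/-- `ε`-disjointness of a quasitiling. -/
def EpsDisjoint (𝒯 : Quasitiling G) (ε : ℝ) : Prop := ∃ f, 𝒯.EpsDisjointWith ε f

/-- The tiles are pairwise disjoint. -/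
def TilesDisjoint (𝒯 : Quasitiling G) : Prop :=
  ∀ S c S' c', 𝒯.IsTile S c → 𝒯.IsTile S' c' → (S, c) ≠ (S', c') →
    Disjoint (rMul S c) (rMul S' c')

/-- `α`-covering: the union of the tiles has lower Banach density at least `α`. -/
def Covering (𝒯 : Quasitiling G) (α : ℝ) : Prop := α ≤ lowerBD 𝒯.union

/-- An exact tiling: the tiles form a partition of `G`. -/
def IsExactTiling (𝒯 : Quasitiling G) : Prop := 𝒯.TilesDisjoint ∧ 𝒯.union = Set.univ

/-- The symbolic representation `x_𝒯` of a quasitiling, over the alphabet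
`𝒮(𝒯) ∪ {0}` (encoded as `Option (Finset G)`, with `none` playing the role of `0`):
`x_𝒯(g) = S` iff `g ∈ C(S)`. -/
noncomputable def symb (𝒯 : Quasitiling G) : G → Option (Finset G) :=
  fun g => if h : ∃ S, S ∈ 𝒯.shapes ∧ g ∈ 𝒯.centers S then some h.choose else none

/-- The entropy of a quasitiling: the topological entropy of the shift-orbit closure of
its symbolic representation. -/
noncomputable def entropy (𝒯 : Quasitiling G) : ℝ := pointEntropy 𝒯.symb

end Quasitiling

/-- `𝒯'` is congruent with `𝒯` (each tile of `𝒯'` is a union of tiles of `𝒯`). -/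
def Congruent [Group G] (𝒯 𝒯' : Quasitiling G) : Prop :=
  ∀ S c, 𝒯'.IsTile S c → ∃ P : Set (Finset G × G),
    (∀ p ∈ P, 𝒯.IsTile p.1 p.2) ∧
    (↑(rMul S c) : Set G) = ⋃ p ∈ P, (↑(rMul p.1 p.2) : Set G)

/-- The union over all tiles `(S,c)` of the assigned subsets `f S c`. -/
def subUnion [Group G] (𝒯 : Quasitiling G) (f : Finset G → G → Finset G) : Set G :=
  ⋃ S ∈ 𝒯.shapes, ⋃ c ∈ 𝒯.centers S, (↑(f S c) : Set G)

end AmenableTilings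
namespace AmenableTilings

theorem isOpen_cylinder {G Λ : Type*} [TopologicalSpace Λ] [DiscreteTopology Λ]
    (F : Finset G) (B : {a // a ∈ F} → Λ) :
    IsOpen {y : G → Λ | ∀ f : {a // a ∈ F}, y f.1 = B f} := by
  have h : {y : G → Λ | ∀ f : {a // a ∈ F}, y f.1 = B f} =
      ⋂ f : {a // a ∈ F}, (fun y : G → Λ => y f.1) ⁻¹' {B f} := by
    ext y
    simp
  rw [h]
  exact isOpen_iInter_of_finite fun f =>
    (isOpen_discrete {B f}).preimage (continuous_apply f.1)

section

variable {G : Type*} [Group G]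

theorem interCard_eq_card_filter (S : Set G) (K : Finset G) (g : G) :
    interCard S K g = (K.filter (fun k => k * g ∈ S)).card := by
  unfold interCard rMul
  rw [Finset.filter_image, Finset.card_image_of_injective _ (mul_left_injective g)]

theorem interCard_le_card (S : Set G) (K : Finset G) (g : G) : interCard S K g ≤ K.card := by
  rw [interCard_eq_card_filter]
  exact Finset.card_filter_le _ _

theorem bddAbove_interCard_div_card (S : Set G) (K : Finset G) :
    BddAbove (Set.range fun g : G => (interCard S K g : ℝ) / (K.card : ℝ)) := by
  refine ⟨1, ?_⟩
  rintro _ ⟨g, rfl⟩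
  exact div_le_one_of_le₀ (by exact_mod_cast interCard_le_card S K g) (Nat.cast_nonneg _)

theorem interCard_le_upperD_mul_card (S : Set G) {K : Finset G} (hK : K.Nonempty) (g : G) :
    (interCard S K g : ℝ) ≤ upperD S K * K.card := by
  have hpos : (0 : ℝ) < K.card := by exact_mod_cast hK.card_pos
  rw [← div_le_iff₀ hpos]
  exact le_ciSup (bddAbove_interCard_div_card S K) g

theorem shift_shift {Λ : Type*} (k g : G) (x : G → Λ) :
    shift k (shift g x) = shift (k * g) x := by
  funext h
  simp [shift, mul_assoc]

theorem continuous_shift {Λ : Type*} [TopologicalSpace Λ] (g : G) :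
    Continuous (shift g : (G → Λ) → G → Λ) :=
  continuous_pi fun h => continuous_apply (h * g)

theorem exists_shift_eqOn_of_mem_closure {Λ : Type*} [TopologicalSpace Λ] [DiscreteTopology Λ]
    {x y : G → Λ} (hy : y ∈ closure {y : G → Λ | ∃ g : G, y = shift g x}) (E : Finset G) :
    ∃ g : G, ∀ a ∈ E, shift g x a = y a := by
  have hopen : IsOpen ((E : Set G).pi fun a => ({y a} : Set Λ)) :=
    isOpen_set_pi E.finite_toSet fun a _ => isOpen_discrete _
  obtain ⟨_, hz, g, rfl⟩ := mem_closure_iff.1 hy _ hopen fun a _ => rfl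
  exact ⟨g, hz⟩

/-- For `y` in the orbit closure of `x`, the number of `k ∈ K` with `ky ∈ [B]` is at most
`D̄_K(S) |K|`, where `S` is the set of occurrences of `B` in `x`. -/
theorem card_filter_shift_mem_cylinder_le {Λ : Type*} [TopologicalSpace Λ] [DiscreteTopology Λ]
    {x y : G → Λ} (hy : y ∈ closure {y : G → Λ | ∃ g : G, y = shift g x})
    (F : Finset G) (B : {a // a ∈ F} → Λ) {K : Finset G} (hK : K.Nonempty) :
    ((K.filter fun k => ∀ f : {a // a ∈ F}, shift k y f.1 = B f).card : ℝ) ≤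
      upperD {g : G | ∀ f : {a // a ∈ F}, shift g x f.1 = B f} K * K.card := by
  obtain ⟨g, hg⟩ := exists_shift_eqOn_of_mem_closure hy (F * K)
  refine le_trans (le_of_eq ?_) (interCard_le_upperD_mul_card _ hK g)
  rw [interCard_eq_card_filter]
  refine congrArg (fun E : Finset G => (E.card : ℝ)) (Finset.ext fun k => ?_)
  simp only [Finset.mem_filter, Set.mem_ofPred_eq]
  refine and_congr_right fun hk => forall_congr' fun f => ?_
  rw [← shift_shift]
  have h := hg (f.1 * k) (Finset.mul_mem_mul f.2 hk)
  change y (f.1 * k) = B f ↔ shift g x (f.1 * k) = B f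
  rw [h]

end

open MeasureTheory in
/-- If `μ` is invariant and almost every point visits `A` at most `c |K|` times along `K`,
then `μ A ≤ c`. -/
theorem measureReal_le_of_ae_card_filter_le {G : Type*} {X : Type*} [MeasurableSpace X]
    {μ : Measure X} [IsProbabilityMeasure μ] {T : G → X → X} (hT : ∀ g, Measurable (T g))
    (hinv : ∀ g, Measure.map (T g) μ = μ) {A : Set X} (hA : MeasurableSet A)
    {K : Finset G} (hK : K.Nonempty) {c : ℝ}
    (h : ∀ᵐ y ∂μ, ((K.filter fun k => T k y ∈ A).card : ℝ) ≤ c * K.card) :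
    μ.real A ≤ c := by
  have hpos : (0 : ℝ) < K.card := by exact_mod_cast hK.card_pos
  have hm (k : G) : MeasurableSet (T k ⁻¹' A) := hT k hA
  have hint (k : G) : Integrable ((T k ⁻¹' A).indicator fun _ => (1 : ℝ)) μ :=
    (integrable_const 1).indicator (hm k)
  have hval (k : G) : ∫ y, (T k ⁻¹' A).indicator (fun _ => (1 : ℝ)) y ∂μ = μ.real A := by
    rw [integral_indicator_const _ (hm k), smul_eq_mul, mul_one,
      ← map_measureReal_apply (hT k) hA, hinv k]
  have hle : ∫ y, ∑ k ∈ K, (T k ⁻¹' A).indicator (fun _ => (1 : ℝ)) y ∂μ ≤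
      ∫ _, c * K.card ∂μ := by
    refine integral_mono_ae (integrable_finsetSum _ fun k _ => hint k) (integrable_const _) ?_
    filter_upwards [h] with y hy
    simpa [Set.indicator_apply, Finset.sum_boole] using hy
  rw [integral_finsetSum _ fun k _ => hint k] at hle
  simp only [hval, Finset.sum_const, nsmul_eq_mul, integral_const, probReal_univ, one_smul] at hle
  rw [mul_comm] at hle
  exact le_of_mul_le_mul_right hle hpos

/-- for an invariant Borel probability measure `μ` supported on the
shift-orbit closure of `x`, the measure of the cylinder `[B]` is bounded by the upper
Banach density of the set of positions at which `B` occurs in `x`. -/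
theorem statement4 {G : Type*} [Group G] [Countable G] (hG : IsAmenable G)
    {Λ : Type*} [Fintype Λ] [TopologicalSpace Λ] [DiscreteTopology Λ]
    [MeasurableSpace (G → Λ)] [BorelSpace (G → Λ)]
    (x : G → Λ) (F : Finset G) (hF : F.Nonempty) (B : {a // a ∈ F} → Λ)
    (μ : MeasureTheory.Measure (G → Λ)) [MeasureTheory.IsProbabilityMeasure μ]
    (hinv : ∀ g : G, MeasureTheory.Measure.map (shift g) μ = μ)
    (hsupp : μ (closure {y : G → Λ | ∃ g : G, y = shift g x}) = 1) :
    μ {y : G → Λ | ∀ f : {a // a ∈ F}, y f.1 = B f} ≤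
      ENNReal.ofReal (upperBD {g : G | ∀ f : {a // a ∈ F}, shift g x f.1 = B f}) := by
  have hcl : ∀ᵐ y ∂μ, y ∈ closure {y : G → Λ | ∃ g : G, y = shift g x} :=
    (MeasureTheory.prob_compl_eq_zero_iff isClosed_closure.measurableSet).2 hsupp
  refine (ENNReal.le_ofReal_iff_toReal_le (MeasureTheory.measure_ne_top _ _) ?_).2 ?_
  · refine Real.sInf_nonneg ?_
    rintro _ ⟨K, -, rfl⟩
    exact Real.iSup_nonneg fun g => by positivity
  · refine le_csInf ⟨_, F, hF, rfl⟩ ?_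
    rintro _ ⟨K, hK, rfl⟩
    refine measureReal_le_of_ae_card_filter_le (fun g => (continuous_shift g).measurable) hinv
      (isOpen_cylinder F B).measurableSet hK ?_
    filter_upwards [hcl] with y hy
    convert card_filter_shift_mem_cylinder_le hy F B hK

end AmenableTilings
end

section
/- Let G be a countable amenable group, ε ∈ (0,1), α ∈ (0,1], and let 𝒯 be a (1-ε)-covering quasitiling of G. Suppose a map T ↦ T♥ assigns to every tile T of 𝒯 a subset T♥ ⊆ T with |T♥| ≥ α|T|, such that the sets T♥ corresponding to distinct tiles are pairwise disjoint. Then the union of the sets T♥ over all tiles of 𝒯 has lower Banach density at least α(1-ε). In particular, if 𝒯 is an ε-disjoint, (1-ε)-covering quasitiling, then the disjoint quasitiling formed by the sets T° from the definition of ε-disjointness is (1-ε)²-covering. -/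
open scoped Pointwise symmDiff Classical
open Filter

namespace AmenableTilings

/-- Membership in a right translate. -/
theorem mem_rMul [Group G] {F : Finset G} {g x : G} : x ∈ rMul F g ↔ x * g⁻¹ ∈ F := by
  simp only [rMul, Finset.mem_image]
  exact ⟨by rintro ⟨a, ha, rfl⟩; simpa using ha, fun h => ⟨_, h, by simp⟩⟩

/-- Membership in a left translate. -/
theorem mem_lMul [Group G] {F : Finset G} {g x : G} : x ∈ lMul g F ↔ g⁻¹ * x ∈ F := by
  simp only [lMul, Finset.mem_image]
  exact ⟨by rintro ⟨a, ha, rfl⟩; simpa using ha, fun h => ⟨_, h, by simp⟩⟩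

theorem card_rMul [Group G] (F : Finset G) (g : G) : (rMul F g).card = F.card :=
  Finset.card_image_of_injective _ (mul_left_injective g)

theorem card_lMul [Group G] (g : G) (F : Finset G) : (lMul g F).card = F.card :=
  Finset.card_image_of_injective _ (mul_right_injective g)

/-- In an amenable group some finite nonempty set is moved arbitrarily little, in total, by
finitely many given left translations. -/
theorem IsAmenable.exists_sum_sdiff_le [Group G] (hG : IsAmenable G) (L : Finset G) {δ : ℝ}
    (hδ : 0 < δ) : ∃ E : Finset G, E.Nonempty ∧
      ∑ l ∈ L, ((lMul l E \ E).card : ℝ) ≤ δ * E.card := by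
  obtain ⟨F, hne, hF⟩ := hG
  have hlim := tendsto_finsetSum L fun l _ => hF l
  rw [Finset.sum_const_zero] at hlim
  obtain ⟨n, hn⟩ := (hlim.eventually (gt_mem_nhds hδ)).exists
  have hpos : (0 : ℝ) < (F n).card := by exact_mod_cast (hne n).card_pos
  refine ⟨F n, hne n, ?_⟩
  rw [← Finset.sum_div, div_lt_iff₀ hpos] at hn
  refine le_trans (Finset.sum_le_sum fun l _ => ?_) hn.le
  exact_mod_cast Finset.card_le_card (le_sup_left : lMul l (F n) \ F n ≤ lMul l (F n) ∆ F n)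

theorem interCard_le [Group G] (A : Set G) (F : Finset G) (g : G) : interCard A F g ≤ F.card :=
  (Finset.card_filter_le _ _).trans (card_rMul F g).le

theorem bddBelow_range_interCard_div [Group G] (A : Set G) (F : Finset G) :
    BddBelow (Set.range fun g : G => (interCard A F g : ℝ) / (F.card : ℝ)) :=
  ⟨0, by rintro _ ⟨g, rfl⟩; positivity⟩

/-- A uniform lower bound for the relative frequency in all right translates of one finite set
bounds the lower Banach density from below. -/
theorem le_lowerBD [Group G] {A : Set G} {F : Finset G} (hF : F.Nonempty) {r : ℝ}
    (h : ∀ g, r * F.card ≤ interCard A F g) : r ≤ lowerBD A := by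
  have hbdd : BddAbove {r : ℝ | ∃ F : Finset G, F.Nonempty ∧ r = lowerD A F} := by
    refine ⟨1, ?_⟩
    rintro _ ⟨E, -, rfl⟩
    refine (ciInf_le (bddBelow_range_interCard_div A E) 1).trans ?_
    exact div_le_one_of_le₀ (by exact_mod_cast interCard_le A E 1) (by positivity)
  refine le_trans (le_ciInf fun g => ?_) (le_csSup hbdd ⟨F, hF, rfl⟩)
  exact (le_div_iff₀ (by exact_mod_cast hF.card_pos)).2 (h g)

/-- Below the lower Banach density there is a finite set all of whose right translates have
larger relative frequency. -/
theorem exists_forall_le_interCard [Group G] {A : Set G} {r : ℝ} (h : r < lowerBD A) :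
    ∃ F : Finset G, F.Nonempty ∧ ∀ g, r * F.card ≤ interCard A F g := by
  obtain ⟨_, ⟨F, hF, rfl⟩, hr⟩ :=
    exists_lt_of_lt_csSup (s := {r : ℝ | ∃ F : Finset G, F.Nonempty ∧ r = lowerD A F})
      ⟨_, {1}, by simp, rfl⟩ h
  refine ⟨F, hF, fun g => ?_⟩
  rw [← le_div_iff₀ (by exact_mod_cast hF.card_pos)]
  exact hr.le.trans (ciInf_le (bddBelow_range_interCard_div A F) g)

/-- Double counting of the pairs `(e, f)` with `f * e * g ∈ A`. -/
theorem sum_interCard_mul [Group G] (A : Set G) (E F : Finset G) (g : G) :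
    ∑ e ∈ E, interCard A F (e * g) = ∑ f ∈ F, interCard A (lMul f E) g := by
  have hcard : ∀ (D : Finset G) (x : G),
      interCard A D x = ∑ d ∈ D, if d * x ∈ A then 1 else 0 := by
    intro D x
    rw [interCard, Finset.card_filter, rMul, Finset.sum_image (mul_left_injective x).injOn]
  have hleft : ∀ f, interCard A (lMul f E) g = ∑ e ∈ E, if f * e * g ∈ A then 1 else 0 := by
    intro f
    rw [hcard, lMul, Finset.sum_image (mul_right_injective f).injOn]
  simp_rw [hleft, hcard]
  rw [Finset.sum_comm]
  simp only [mul_assoc]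

theorem interCard_le_add_sdiff [Group G] (A : Set G) (D E : Finset G) (g : G) :
    interCard A D g ≤ interCard A E g + (D \ E).card := by
  rw [← card_rMul (D \ E) g]
  refine (Finset.card_le_card fun x hx => ?_).trans (Finset.card_union_le _ _)
  simp only [Finset.mem_filter, Finset.mem_union, mem_rMul, Finset.mem_sdiff] at hx ⊢
  tauto

/-- A lower bound for the relative frequency in all right translates of `F` passes to right
translates of a set `E` that is almost invariant under `F`. -/
theorem mul_card_le_interCard_add [Group G] {A : Set G} {F : Finset G} (hF : F.Nonempty) {r : ℝ}
    (h : ∀ g, r * F.card ≤ interCard A F g) (E : Finset G) (g : G) :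
    r * E.card ≤ interCard A E g + ∑ f ∈ F, ((lMul f E \ E).card : ℝ) := by
  have hF1 : (1 : ℝ) ≤ F.card := by exact_mod_cast hF.card_pos
  have hlow : E.card * (r * F.card) ≤ ∑ e ∈ E, (interCard A F (e * g) : ℝ) := by
    rw [← nsmul_eq_mul]
    exact Finset.card_nsmul_le_sum _ _ _ fun e _ => h _
  have hup : ∑ e ∈ E, (interCard A F (e * g) : ℝ)
      ≤ F.card * interCard A E g + ∑ f ∈ F, ((lMul f E \ E).card : ℝ) := by
    have := Finset.sum_le_sum fun f (_ : f ∈ F) => interCard_le_add_sdiff A (lMul f E) E g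
    rw [← sum_interCard_mul, Finset.sum_add_distrib, Finset.sum_const, smul_eq_mul] at this
    exact_mod_cast this
  have hsum : 0 ≤ ∑ f ∈ F, ((lMul f E \ E).card : ℝ) := by positivity
  refine le_of_mul_le_mul_left ?_ (zero_lt_one.trans_le hF1)
  nlinarith

/-- The part of the union of the tiles in a translate `Eg` is, up to a boundary effect, covered by
tiles inside `Eg`, so large disjoint subsets of the tiles have large intersection with `Eg`. -/
theorem mul_interCard_union_le [Group G] {𝒯 : Quasitiling G} {f : Finset G → G → Finset G}
    {α : ℝ} (hα : 0 ≤ α)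
    (hf : ∀ S c, 𝒯.IsTile S c → f S c ⊆ rMul S c ∧ α * (S.card : ℝ) ≤ ((f S c).card : ℝ))
    (hdisj : ∀ S c S' c', 𝒯.IsTile S c → 𝒯.IsTile S' c' → (S, c) ≠ (S', c') →
      Disjoint (f S c) (f S' c')) (E : Finset G) (g : G) :
    α * interCard 𝒯.union E g ≤ interCard (subUnion 𝒯 f) E g +
      α * ∑ k ∈ 𝒯.shapes.biUnion (fun S => S * S⁻¹), ((lMul k E \ E).card : ℝ) := by
  set K := 𝒯.shapes.biUnion (fun S => S * S⁻¹) with hK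
  set P := (𝒯.shapes ×ˢ rMul E g).filter
    fun p => 𝒯.IsTile p.1 p.2 ∧ rMul p.1 p.2 ⊆ rMul E g with hP
  have htile : ∀ p ∈ P, 𝒯.IsTile p.1 p.2 ∧ rMul p.1 p.2 ⊆ rMul E g := fun p hp =>
    (Finset.mem_filter.1 hp).2
  have hinner : (P.biUnion fun p => f p.1 p.2).card ≤ interCard (subUnion 𝒯 f) E g := by
    refine Finset.card_le_card fun x hx => ?_
    obtain ⟨p, hp, hxp⟩ := Finset.mem_biUnion.1 hx
    obtain ⟨ht, hsub⟩ := htile p hp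
    refine Finset.mem_filter.2 ⟨hsub ((hf _ _ ht).1 hxp), ?_⟩
    simp only [subUnion, Set.mem_iUnion]
    exact ⟨p.1, ht.1, p.2, ht.2, hxp⟩
  have hcard : (P.biUnion fun p => f p.1 p.2).card = ∑ p ∈ P, (f p.1 p.2).card :=
    Finset.card_biUnion fun p hp q hq hpq => hdisj _ _ _ _ (htile p hp).1 (htile q hq).1 hpq
  have hlarge : α * ∑ p ∈ P, (p.1.card : ℝ) ≤ ∑ p ∈ P, ((f p.1 p.2).card : ℝ) := by
    rw [Finset.mul_sum]
    exact Finset.sum_le_sum fun p hp => (hf _ _ (htile p hp).1).2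
  have houter : interCard 𝒯.union E g ≤
      ∑ p ∈ P, p.1.card + ∑ k ∈ K, (lMul k E \ E).card := by
    have hsub : (rMul E g).filter (· ∈ 𝒯.union) ⊆ (P.biUnion fun p => rMul p.1 p.2) ∪
        K.biUnion fun k => rMul (lMul k⁻¹ (lMul k E \ E)) g := by
      intro x hx
      obtain ⟨hxE, hxU⟩ := Finset.mem_filter.1 hx
      simp only [Quasitiling.union, Set.mem_iUnion] at hxU
      obtain ⟨S, hS, c, hc, hxS⟩ := hxU
      rw [Finset.mem_coe] at hxS
      rw [Finset.mem_union, Finset.mem_biUnion, Finset.mem_biUnion]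
      by_cases hin : rMul S c ⊆ rMul E g
      · refine Or.inl ⟨(S, c), Finset.mem_filter.2 ⟨Finset.mem_product.2 ⟨hS, ?_⟩, ⟨hS, hc⟩, hin⟩,
          hxS⟩
        exact hin (mem_rMul.2 (by simpa using 𝒯.one_mem S hS))
      · obtain ⟨y, hyS, hyE⟩ := Finset.not_subset.1 hin
        refine Or.inr ⟨y * x⁻¹, Finset.mem_biUnion.2 ⟨S, hS, Finset.mem_mul.2
          ⟨y * c⁻¹, mem_rMul.1 hyS, (x * c⁻¹)⁻¹, Finset.inv_mem_inv (mem_rMul.1 hxS), ?_⟩⟩, ?_⟩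
        · group
        · rw [mem_rMul] at hxE hyE
          simp only [mem_rMul, mem_lMul, Finset.mem_sdiff]
          refine ⟨by simpa [mul_assoc] using hxE, by simpa [mul_assoc] using hyE⟩
    refine (Finset.card_le_card hsub).trans ((Finset.card_union_le _ _).trans (add_le_add ?_ ?_))
    · simpa only [card_rMul] using Finset.card_biUnion_le (s := P) (t := fun p => rMul p.1 p.2)
    · simpa only [card_rMul, card_lMul] using Finset.card_biUnion_le (s := K)
        (t := fun k => rMul (lMul k⁻¹ (lMul k E \ E)) g)
  have houter' : (interCard 𝒯.union E g : ℝ) ≤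
      ∑ p ∈ P, (p.1.card : ℝ) + ∑ k ∈ K, ((lMul k E \ E).card : ℝ) := by exact_mod_cast houter
  have hinner' : ∑ p ∈ P, ((f p.1 p.2).card : ℝ) ≤ interCard (subUnion 𝒯 f) E g := by
    rw [hcard] at hinner
    exact_mod_cast hinner
  linarith [mul_le_mul_of_nonneg_left houter' hα]

/-- Disjoint `α`-subsets of the tiles of a quasitiling retain at least the proportion `α` of the
lower Banach density of its union. -/
theorem mul_le_lowerBD_subUnion [Group G] (hG : IsAmenable G) {𝒯 : Quasitiling G}
    {f : Finset G → G → Finset G} {α β : ℝ} (hα : 0 < α) (hβ : 𝒯.Covering β)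
    (hf : ∀ S c, 𝒯.IsTile S c → f S c ⊆ rMul S c ∧ α * (S.card : ℝ) ≤ ((f S c).card : ℝ))
    (hdisj : ∀ S c S' c', 𝒯.IsTile S c → 𝒯.IsTile S' c' → (S, c) ≠ (S', c') →
      Disjoint (f S c) (f S' c')) : α * β ≤ lowerBD (subUnion 𝒯 f) := by
  refine le_of_forall_pos_le_add fun η hη => ?_
  obtain ⟨δ, hδ, rfl⟩ : ∃ δ, 0 < δ ∧ α * (3 * δ) = η :=
    ⟨η / (3 * α), by positivity, by field_simp⟩
  obtain ⟨F, hF, hFr⟩ :=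
    exists_forall_le_interCard (show β - δ < lowerBD 𝒯.union from (sub_lt_self β hδ).trans_le hβ)
  set K := 𝒯.shapes.biUnion (fun S => S * S⁻¹)
  obtain ⟨E, hE, hsum⟩ := hG.exists_sum_sdiff_le (F ∪ K) hδ
  have hsumF : ∑ l ∈ F, ((lMul l E \ E).card : ℝ) ≤ δ * E.card :=
    (Finset.sum_le_sum_of_subset_of_nonneg Finset.subset_union_left
      fun _ _ _ => by positivity).trans hsum
  have hsumK : ∑ l ∈ K, ((lMul l E \ E).card : ℝ) ≤ δ * E.card :=
    (Finset.sum_le_sum_of_subset_of_nonneg Finset.subset_union_right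
      fun _ _ _ => by positivity).trans hsum
  rw [← sub_le_iff_le_add]
  refine le_lowerBD hE fun g => ?_
  have hcover := mul_card_le_interCard_add hF hFr E g
  have htiles := mul_interCard_union_le hα.le hf hdisj E g
  calc (α * β - α * (3 * δ)) * E.card
      = α * ((β - δ) * E.card - δ * E.card) - α * (δ * E.card) := by ring
    _ ≤ α * interCard 𝒯.union E g - α * ∑ l ∈ K, ((lMul l E \ E).card : ℝ) := by
        gcongr
        linarith
    _ ≤ interCard (subUnion 𝒯 f) E g := by linarith

/-- if `𝒯` is a `(1-ε)`-covering quasitiling and `T ↦ T♥` assigns pairwise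
disjoint `α`-subsets to its tiles, then the union of the sets `T♥` has lower Banach
density at least `α(1-ε)`. In particular, for an `ε`-disjoint `(1-ε)`-covering `𝒯`, the
union of the disjoint sets `T°` witnessing `ε`-disjointness has lower Banach density at
least `(1-ε)²` (i.e. the resulting disjoint quasitiling is `(1-ε)²`-covering). -/
theorem statement6 {G : Type*} [Group G] [Countable G] (hG : IsAmenable G)
    (ε : ℝ) (hε : ε ∈ Set.Ioo (0 : ℝ) 1) (α : ℝ) (hα : α ∈ Set.Ioc (0 : ℝ) 1) :
    (∀ (𝒯 : Quasitiling G) (f : Finset G → G → Finset G),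
        𝒯.Covering (1 - ε) →
        (∀ S c, 𝒯.IsTile S c →
          f S c ⊆ rMul S c ∧ α * (S.card : ℝ) ≤ ((f S c).card : ℝ)) →
        (∀ S c S' c', 𝒯.IsTile S c → 𝒯.IsTile S' c' → (S, c) ≠ (S', c') →
          Disjoint (f S c) (f S' c')) →
        α * (1 - ε) ≤ lowerBD (subUnion 𝒯 f)) ∧
    (∀ (𝒯 : Quasitiling G) (f : Finset G → G → Finset G),
        𝒯.Covering (1 - ε) → 𝒯.EpsDisjointWith ε f →
        (1 - ε) ^ 2 ≤ lowerBD (subUnion 𝒯 f)) := by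
  refine ⟨fun 𝒯 f hcov hf hdisj => mul_le_lowerBD_subUnion hG hα.1 hcov hf hdisj,
    fun 𝒯 f hcov hf => ?_⟩
  rw [sq]
  exact mul_le_lowerBD_subUnion hG (sub_pos.2 hε.2) hcov hf.1 hf.2

end AmenableTilings
end

section
/- Let G be a countable amenable group, let Λ be a finite alphabet in which one element is selected and called 0, and let ε > 0. There exists δ > 0 such that every x ∈ Λ^G for which the set {g ∈ G : x(g) ≠ 0} has upper Banach density smaller than δ satisfies h(x) < ε, where h(x) is the topological entropy of the shift-orbit closure of x. -/
open scoped Pointwise symmDiff Classical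
open Filter

namespace AmenableTilings

/-- Exponential Chebyshev bound for the number of words with few letters different from `z`. -/
theorem card_le_of_sparse {ι Λ : Type*} [Fintype ι] [Fintype Λ] (z : Λ)
    (A : Finset (ι → Λ)) {t d : ℝ} (ht : 0 < t) (ht1 : t ≤ 1)
    (hA : ∀ y ∈ A, ((Finset.univ.filter fun i => y i ≠ z).card : ℝ) ≤ d) :
    (A.card : ℝ) * t ^ d ≤ (1 + Fintype.card Λ * t) ^ Fintype.card ι := by
  set w : Λ → ℝ := fun a => if a = z then 1 else t with hw
  have hw0 : ∀ a, 0 ≤ w a := fun a => by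
    simp only [hw]; split_ifs <;> linarith
  have hprod : ∀ y : ι → Λ,
      ∏ i, w (y i) = t ^ (Finset.univ.filter fun i => y i ≠ z).card := fun y => by
    simp only [hw, Finset.prod_ite, Finset.prod_const_one, one_mul, Finset.prod_const, ne_eq]
  have hsum : ∑ a, w a ≤ 1 + Fintype.card Λ * t := by
    calc ∑ a, w a ≤ ∑ a, ((if a = z then 1 else 0) + t) := by
          refine Finset.sum_le_sum fun a _ => ?_
          simp only [hw]; split_ifs <;> linarith
      _ = 1 + Fintype.card Λ * t := by simp [Finset.sum_add_distrib]
  calc (A.card : ℝ) * t ^ d = ∑ _y ∈ A, t ^ d := by simp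
    _ ≤ ∑ y ∈ A, ∏ i, w (y i) := by
        refine Finset.sum_le_sum fun y hy => ?_
        rw [hprod, ← Real.rpow_natCast]
        exact Real.rpow_le_rpow_of_exponent_ge ht ht1 (hA y hy)
    _ ≤ ∑ y : ι → Λ, ∏ i, w (y i) :=
        Finset.sum_le_sum_of_subset_of_nonneg (Finset.subset_univ _)
          fun y _ _ => Finset.prod_nonneg fun i _ => hw0 _
    _ = (∑ a, w a) ^ Fintype.card ι := by
        rw [← Fintype.piFinset_univ, ← Finset.prod_univ_sum]
        simp
    _ ≤ _ := pow_le_pow_left₀ (Finset.sum_nonneg fun a _ => hw0 a) hsum _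

/-- Every block with finite domain occurring in the orbit closure occurs in the orbit. -/
theorem exists_shift_eqOn_of_mem_orbitClosure [Group G] {Λ : Type*} {x y : G → Λ}
    (hy : y ∈ orbitClosure x) (F : Finset G) : ∃ g, ∀ h ∈ F, y h = x (h * g) := by
  let _ : TopologicalSpace Λ := ⊥
  have : DiscreteTopology Λ := ⟨rfl⟩
  have hopen : IsOpen ((F : Set G).pi fun h => ({y h} : Set Λ)) :=
    isOpen_set_pi F.finite_toSet fun _ _ => isOpen_discrete _
  obtain ⟨u, hu, g, rfl⟩ := mem_closure_iff.1 hy _ hopen fun h _ => rfl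
  exact ⟨g, fun h hh => (hu h hh).symm⟩

theorem entropyOf_le [Group G] {Λ : Type*} (X : Set (G → Λ)) {F : Finset G} (hF : F.Nonempty) :
    entropyOf X ≤ Real.logb 2 (complexity X F) / F.card := by
  refine csInf_le ⟨0, ?_⟩ ⟨F, hF, rfl⟩
  rintro r ⟨F', -, rfl⟩
  refine div_nonneg ?_ (Nat.cast_nonneg _)
  exact div_nonneg (Real.log_natCast_nonneg _) (Real.log_nonneg one_le_two)

theorem exists_interCard_le_of_upperBD_lt [Group G] {S : Set G} {δ : ℝ} (h : upperBD S < δ) :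
    ∃ F : Finset G, F.Nonempty ∧ ∀ g, (interCard S F g : ℝ) ≤ δ * F.card := by
  have hne : {r : ℝ | ∃ F : Finset G, F.Nonempty ∧ r = upperD S F}.Nonempty :=
    ⟨_, {1}, Finset.singleton_nonempty _, rfl⟩
  obtain ⟨r, ⟨F, hF, rfl⟩, hr⟩ := exists_lt_of_csInf_lt hne h
  have hF0 : (0 : ℝ) < F.card := by exact_mod_cast hF.card_pos
  have hbdd : BddAbove (Set.range fun g => (interCard S F g : ℝ) / F.card) := by
    refine ⟨1, ?_⟩
    rintro _ ⟨g, rfl⟩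
    refine div_le_one_of_le₀ ?_ hF0.le
    exact_mod_cast (Finset.card_filter_le _ _).trans Finset.card_image_le
  exact ⟨F, hF, fun g => (div_le_iff₀ hF0).1 ((le_ciSup hbdd g).trans hr.le)⟩

theorem card_filter_shift_ne [Group G] {Λ : Type*} (x : G → Λ) (z : Λ) (F : Finset G) (g : G) :
    (Finset.univ.filter fun i : {a // a ∈ F} => x (i * g) ≠ z).card
      = interCard {g | x g ≠ z} F g := by
  unfold interCard rMul
  refine Finset.card_bij (fun i _ => i.1 * g) ?_ ?_ ?_
  · rintro ⟨a, ha⟩ h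
    simpa [ha] using h
  · rintro a - b - h
    exact Subtype.ext (mul_right_cancel h)
  · intro b hb
    simp only [Finset.mem_filter, Finset.mem_image] at hb
    obtain ⟨⟨a, ha, rfl⟩, hbx⟩ := hb
    exact ⟨⟨a, ha⟩, by simpa using hbx, rfl⟩

theorem log_complexity_le [Group G] {Λ : Type*} [Fintype Λ] (z : Λ) (x : G → Λ) {F : Finset G}
    {δ t : ℝ} (hδ : 0 ≤ δ) (ht : 0 < t) (ht1 : t ≤ 1)
    (hF : ∀ g, (interCard {g | x g ≠ z} F g : ℝ) ≤ δ * F.card) :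
    Real.log (complexity (orbitClosure x) F)
      ≤ F.card * (Fintype.card Λ * t - δ * Real.log t) := by
  have hlog : Real.log t ≤ 0 := Real.log_nonpos ht.le ht1
  set A := (fun y (f : {a // a ∈ F}) => y f.1) '' orbitClosure x
  have hcard : complexity (orbitClosure x) F = A.toFinset.card := by
    rw [← Set.ncard_eq_toFinset_card']; rfl
  have key := card_le_of_sparse z A.toFinset ht ht1 (d := δ * F.card) (by
    intro y hy
    obtain ⟨u, hu, rfl⟩ := Set.mem_toFinset.1 hy
    obtain ⟨g, hg⟩ := exists_shift_eqOn_of_mem_orbitClosure hu F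
    refine le_trans (le_of_eq ?_) (hF g)
    rw [← card_filter_shift_ne]
    congr 2
    ext i
    simp [hg i.1 i.2])
  have hm : 0 ≤ (Fintype.card Λ : ℝ) * t := mul_nonneg (Nat.cast_nonneg _) ht.le
  rw [hcard]
  rcases Nat.eq_zero_or_pos A.toFinset.card with h0 | hpos
  · rw [h0, Nat.cast_zero, Real.log_zero]
    exact mul_nonneg (Nat.cast_nonneg _) (by nlinarith)
  have hpos' : (0 : ℝ) < A.toFinset.card := by exact_mod_cast hpos
  have hb : 0 < 1 + Fintype.card Λ * t := by positivity
  have h1 := Real.log_le_log (by positivity) key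
  rw [Real.log_mul hpos'.ne' (Real.rpow_pos_of_pos ht _).ne', Real.log_rpow ht, Real.log_pow,
    Fintype.card_coe] at h1
  have h2 := Real.log_le_sub_one_of_pos hb
  nlinarith [mul_le_mul_of_nonneg_left h2 (Nat.cast_nonneg (α := ℝ) F.card)]

/-- for a finite alphabet with a selected symbol `z` ("zero") and `ε > 0`,
there is `δ > 0` such that every symbolic element whose set of non-zero positions has
upper Banach density smaller than `δ` has entropy less than `ε`. -/
theorem statement9 {G : Type*} [Group G] [Countable G] (hG : IsAmenable G)
    {Λ : Type*} [Fintype Λ] (z : Λ) (ε : ℝ) (hε : 0 < ε) :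
    ∃ δ : ℝ, 0 < δ ∧
      ∀ x : G → Λ, upperBD {g : G | x g ≠ z} < δ → pointEntropy x < ε := by
  have hc : 0 < Real.log 2 := Real.log_pos one_lt_two
  set m : ℝ := (Fintype.card Λ : ℝ)
  have hm : 0 ≤ m := Nat.cast_nonneg _
  obtain ⟨t, ht, ht1, hmt⟩ : ∃ t : ℝ, 0 < t ∧ t ≤ 1 ∧ m * t < Real.log 2 * ε / 2 := by
    refine ⟨min 1 (Real.log 2 * ε / 2 / (m + 1)), by positivity, min_le_left _ _, ?_⟩
    refine (mul_le_mul_of_nonneg_left (min_le_right _ _) hm).trans_lt ?_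
    rw [mul_div_assoc', div_lt_iff₀ (by positivity), mul_comm]
    exact mul_lt_mul_of_pos_left (lt_add_one m) (by positivity)
  have hL : 0 ≤ -Real.log t := neg_nonneg.2 (Real.log_nonpos ht.le ht1)
  have hδ : 0 < Real.log 2 * ε / 2 / (-Real.log t + 1) := by positivity
  refine ⟨_, hδ, fun x hx => ?_⟩
  obtain ⟨F, hF, hFS⟩ := exists_interCard_le_of_upperBD_lt hx
  refine (entropyOf_le _ hF).trans_lt ?_
  have hF0 : (0 : ℝ) < F.card := by exact_mod_cast hF.card_pos
  have h1 := log_complexity_le z x hδ.le ht ht1 hFS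
  have h2 := div_mul_cancel₀ (Real.log 2 * ε / 2) (by positivity : -Real.log t + 1 ≠ 0)
  rw [Real.logb, div_div, div_lt_iff₀ (by positivity)]
  refine h1.trans_lt ?_
  rw [show ε * (Real.log 2 * F.card) = F.card * (Real.log 2 * ε) by ring]
  exact mul_lt_mul_of_pos_left (by linarith) hF0

end AmenableTilings
end
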